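/- arXiv:2503.18200 — 3 statements merged into one kernel-verified Lean document; each statement's English description precedes it below -/
import Mathlib

section
/- Lemma 3.1 (stabilizer-free lower bound for E_w): Let k ≥ 1 and r = 2N + k − 2. There exists a constant C > 0 such that for every discrete weak function v = (v₀, (v_{b,i}), (v_{g,i})) of order k on T and every w ∈ P_r satisfying ∫_T w φ dx = ∫_T v₀ Eφ dx − Σ_{i=1}^N ∫_{e_i} v_{b,i} (κ∇φ)·n_i dH^{d−1} + Σ_{i=1}^N ∫_{e_i} v_{g,i} φ dH^{d−1} for all φ ∈ P_r, one has ‖E v₀‖_{L²(T)} ≤ C ‖w‖_{L²(T)}. -/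
open MeasureTheory RealInnerProductSpace
open scoped BigOperators

noncomputable section

/-- `f` is (the evaluation of) a real polynomial in `d` variables of total degree at most `r`. -/
def IsPolyDeg (d r : ℕ) (f : EuclideanSpace ℝ (Fin d) → ℝ) : Prop :=
  ∃ P : MvPolynomial (Fin d) ℝ, P.totalDegree ≤ r ∧
    ∀ x : EuclideanSpace ℝ (Fin d), f x = MvPolynomial.eval (fun j => x j) P

/-- Partial derivative in the `i`-th coordinate direction. -/
def pder (d : ℕ) (i : Fin d) (f : EuclideanSpace ℝ (Fin d) → ℝ) :
    EuclideanSpace ℝ (Fin d) → ℝ :=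
  fun x => fderiv ℝ f x (EuclideanSpace.single i (1 : ℝ))

/-- The second-order elliptic operator `E f = ∇·(κ∇f) = Σ_{i,j} κ_{ij} ∂_i ∂_j f`
for a constant matrix `κ`. -/
def Eop (d : ℕ) (κ : Matrix (Fin d) (Fin d) ℝ) (f : EuclideanSpace ℝ (Fin d) → ℝ) :
    EuclideanSpace ℝ (Fin d) → ℝ :=
  fun x => ∑ i, ∑ j, κ i j * pder d i (pder d j f) x

/-- `(κ ∇ f) · ν`. -/
def kGradDot (d : ℕ) (κ : Matrix (Fin d) (Fin d) ℝ) (f : EuclideanSpace ℝ (Fin d) → ℝ)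
    (ν : EuclideanSpace ℝ (Fin d)) : EuclideanSpace ℝ (Fin d) → ℝ :=
  fun x => (∑ a, (∑ b, κ a b * pder d b f x) * ν a)

/-- The affine function `l_i(x) = h_T⁻¹ ⟨x - A_i, n_i⟩` vanishing on the face `e_i`. -/
def lfun (d N : ℕ) (hT : ℝ) (A n : Fin N → EuclideanSpace ℝ (Fin d)) (i : Fin N) :
    EuclideanSpace ℝ (Fin d) → ℝ :=
  fun x => hT⁻¹ * ⟪(x - A i), (n i)⟫

/-- Orthogonal projection onto the hyperplane `{x | ⟨x - A, n⟩ = 0}` (for `‖n‖ = 1`). -/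
def projH (d : ℕ) (A n : EuclideanSpace ℝ (Fin d)) :
    EuclideanSpace ℝ (Fin d) → EuclideanSpace ℝ (Fin d) :=
  fun X => X - ⟪X - A, n⟫ • n


open MvPolynomial in
theorem aux_contDiff (d : ℕ) (P : MvPolynomial (Fin d) ℝ) :
    ContDiff ℝ 1 (fun x : EuclideanSpace ℝ (Fin d) => eval (fun j => x j) P) := by
  induction P using MvPolynomial.induction_on with
  | C a => simpa using contDiff_const
  | add p q hp hq => simpa using hp.add hq
  | mul_X p i hp => 
    simp only [map_mul, eval_X]
    exact hp.mul (by fun_prop)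

open MvPolynomial in
theorem aux_pder (d : ℕ) (P : MvPolynomial (Fin d) ℝ) (i : Fin d)  :
    pder d i (fun x => eval (fun j => x j) P) = fun x => eval (fun j => x j) (pderiv i P) := by
  funext x
  unfold pder
  induction P using MvPolynomial.induction_on with
  | C a => simp
  | add p q hp hq => 
    simp only [map_add]
    rw [fderiv_fun_add ((aux_contDiff d p).differentiable one_ne_zero x) 
      ((aux_contDiff d q).differentiable one_ne_zero x)]
    simp [hp, hq]
  | mul_X p j hp =>
    simp only [map_mul, eval_X, pderiv_mul, map_add]
    have h2 : HasFDerivAt (fun x : EuclideanSpace ℝ (Fin d) => x j) 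
      (EuclideanSpace.proj j : EuclideanSpace ℝ (Fin d) →L[ℝ] ℝ) x := 
      (EuclideanSpace.proj j : EuclideanSpace ℝ (Fin d) →L[ℝ] ℝ).hasFDerivAt
    rw [fderiv_fun_mul ((aux_contDiff d p).differentiable one_ne_zero x) h2.differentiableAt,
      h2.fderiv]
    simp only [add_apply, smul_apply, hp, smul_eq_mul,
      PiLp.proj_apply]
    by_cases hij : j = i
    · subst hij; simp; ring
    · simp [pderiv_X_of_ne hij, hij]; ring

open MvPolynomial in
theorem aux_deg (d : ℕ) (P : MvPolynomial (Fin d) ℝ) (i : Fin d) :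
    (pderiv i P).totalDegree ≤ P.totalDegree - 1 := by
  refine Finset.sup_le ?_
  intro m hm
  rw [mem_support_iff, coeff_pderiv] at hm
  have h1 : coeff (m + Finsupp.single i 1) P ≠ 0 := fun h => hm (by simp [h])
  have h2 := le_totalDegree (mem_support_iff.2 h1)
  have h3 : ((m + Finsupp.single i 1).sum fun _ e => e) = (m.sum fun _ e => e) + 1 := by
    rw [Finsupp.sum_add_index' (by simp) (by simp)]; simp
  rw [h3] at h2
  omega

theorem aux_hyper (d : ℕ) (A n : EuclideanSpace ℝ (Fin d)) (hn : ‖n‖ = 1) :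
    volume {x : EuclideanSpace ℝ (Fin d) | ⟪x - A, n⟫ = 0} = 0 := by
  have hne : n ≠ 0 := by intro h; simp [h] at hn
  refine measure_mono_null ?_ (Measure.addHaar_affineSubspace volume 
    (AffineSubspace.mk' A (ℝ ∙ n)ᗮ) ?_)
  · intro x hx
    simp only [Set.mem_ofPred_eq] at hx
    simp only [SetLike.mem_coe, AffineSubspace.mem_mk', vsub_eq_sub]
    rw [Submodule.mem_orthogonal_singleton_iff_inner_left]
    exact hx
  · intro h
    have h2 : A + n ∈ AffineSubspace.mk' A (ℝ ∙ n)ᗮ := by rw [h]; trivial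
    simp only [AffineSubspace.mem_mk', vsub_eq_sub, add_sub_cancel_left] at h2
    rw [Submodule.mem_orthogonal_singleton_iff_inner_left] at h2
    exact hne (inner_self_eq_zero.1 h2)

theorem aux_lip (d : ℕ) (T : Set (EuclideanSpace ℝ (Fin d))) (hT : IsOpen T)
    (f : EuclideanSpace ℝ (Fin d) → ℝ) (C : NNReal) (hf : LipschitzWith C f) 
    (h0 : ∀ x ∈ frontier T, f x = 0) : LipschitzWith C (T.indicator f) := by
  have key : ∀ x ∈ T, ∀ y ∉ T, dist (f x) 0 ≤ C * dist x y := by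
    intro x hx y hy
    have : ∃ z ∈ segment ℝ x y, z ∈ frontier T := by
      by_contra! h
      have := (convex_segment (𝕜 := ℝ) x y).isPreconnected.subset_of_closure_inter_subset hT
        ⟨x, left_mem_segment ℝ x y, hx⟩ (by
          intro z hz
          by_contra hzT
          refine h z hz.2 ⟨hz.1, ?_⟩
          rwa [hT.interior_eq])
      exact hy (this (right_mem_segment ℝ x y))
    obtain ⟨z, hz, hzT⟩ := this
    rw [← h0 z hzT]
    refine (hf.dist_le_mul x z).trans ?_
    gcongr
    have := dist_add_dist_of_mem_segment hz
    linarith [dist_nonneg (x := z) (y := y)]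
  refine LipschitzWith.of_dist_le_mul fun x y => ?_
  by_cases hx : x ∈ T <;> by_cases hy : y ∈ T
  · simpa [hx, hy] using hf.dist_le_mul x y
  · simpa [hx, hy] using key x hx y hy
  · have := key y hy x hx
    rw [dist_comm, dist_comm y x] at this
    simpa [hx, hy] using this
  · simp [hx, hy]; positivity

theorem aux_div (d : ℕ) (T : Set (EuclideanSpace ℝ (Fin d))) (hT : IsOpen T)
    (hb : Bornology.IsBounded T) (hnull : volume (frontier T) = 0)
    (f : EuclideanSpace ℝ (Fin d) → ℝ) (hf : ContDiff ℝ 1 f) 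
    (h0 : ∀ x ∈ frontier T, f x = 0) (v : EuclideanSpace ℝ (Fin d)) :
    ∫ x in T, fderiv ℝ f x v = 0 := by
  obtain ⟨R, hR0, hR⟩ := hb.subset_ball_lt 0 (0 : EuclideanSpace ℝ (Fin d))
  let χ : ContDiffBump (0 : EuclideanSpace ℝ (Fin d)) := ⟨R, R + 1, hR0, by linarith⟩
  have hχ1 : ∀ x ∈ T, χ =ᶠ[nhds x] 1 := fun x hx => χ.eventuallyEq_one_of_mem_ball (hR hx)
  obtain ⟨C, hC⟩ := ContDiff.lipschitzWith_of_hasCompactSupport (𝕂 := ℝ) (n := 1) 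
    (f := fun x => χ x * f x) (χ.hasCompactSupport.mul_right) (χ.contDiff.mul hf) one_ne_zero
  obtain ⟨D, hD⟩ := ContDiff.lipschitzWith_of_hasCompactSupport (𝕂 := ℝ) (n := 1) 
    χ.hasCompactSupport χ.contDiff one_ne_zero
  have hF := aux_lip d T hT _ C hC (fun x hx => by simp [h0 x hx])
  have key := LipschitzWith.integral_lineDeriv_mul_eq (μ := volume) hF hD χ.hasCompactSupport v
  have hR : ∫ x, lineDeriv ℝ χ x (-v) * T.indicator (fun x => χ x * f x) x = 0 := by
    rw [← integral_zero (EuclideanSpace ℝ (Fin d)) ℝ (μ := volume)]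
    congr 1
    funext x
    by_cases hx : x ∈ T
    · have : HasFDerivAt χ (0 : EuclideanSpace ℝ (Fin d) →L[ℝ] ℝ) x := 
        (hasFDerivAt_const (1:ℝ) x).congr_of_eventuallyEq (hχ1 x hx)
      rw [(this.hasLineDerivAt (-v)).lineDeriv]; simp
    · simp [hx]
  rw [hR] at key
  rw [← key, ← integral_indicator hT.measurableSet]
  apply integral_congr_ae
  have : ∀ᵐ x ∂(volume : Measure (EuclideanSpace ℝ (Fin d))), x ∉ frontier T := 
    measure_eq_zero_iff_ae_notMem.1 hnull
  filter_upwards [this] with x hx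
  by_cases hxT : x ∈ T
  · have h1 : T.indicator (fun x => χ x * f x) =ᶠ[nhds x] f := by
      filter_upwards [hχ1 x hxT, hT.mem_nhds hxT] with y hy hyT
      simp [hyT, hy]
    have h2 : HasFDerivAt (T.indicator (fun x => χ x * f x)) (fderiv ℝ f x) x :=
      ((hf.differentiable one_ne_zero x).hasFDerivAt).congr_of_eventuallyEq h1
    rw [(h2.hasLineDerivAt v).lineDeriv, (hχ1 x hxT).eq_of_nhds]
    simp [hxT]
  · have hxc : x ∉ closure T := fun h => hx ⟨h, by rwa [hT.interior_eq]⟩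
    have h1 : T.indicator (fun x => χ x * f x) =ᶠ[nhds x] fun _ => 0 := by
      filter_upwards [isClosed_closure.isOpen_compl.mem_nhds hxc] with y hy
      have : y ∉ T := fun h => hy (subset_closure h)
      simp [this]
    have h2 := (hasFDerivAt_const (𝕜 := ℝ) (0:ℝ) x).congr_of_eventuallyEq h1
    rw [(h2.hasLineDerivAt v).lineDeriv]
    simp [hxT]

theorem aux_fin {V F G : Type*} [AddCommGroup V] [Module ℝ V] [FiniteDimensional ℝ V]
    [NormedAddCommGroup F] [NormedSpace ℝ F] [NormedAddCommGroup G] [NormedSpace ℝ G]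
    (f : V →ₗ[ℝ] F) (g : V →ₗ[ℝ] G) (h : ∀ v, g v = 0 → f v = 0) :
    ∃ C > (0:ℝ), ∀ v, ‖f v‖ ≤ C * ‖g v‖ := by
  obtain ⟨s, hs⟩ := g.rangeRestrict.exists_rightInverse_of_surjective g.range_rangeRestrict
  let L : g.range →L[ℝ] F := (f.comp s).toContinuousLinearMap
  refine ⟨‖L‖ + 1, by positivity, fun v => ?_⟩
  have h1 : g (s (g.rangeRestrict v)) = g v := by
    have := LinearMap.congr_fun hs (g.rangeRestrict v)
    exact congrArg Subtype.val this
  have h2 : f v = L (g.rangeRestrict v) := by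
    have := h (v - s (g.rangeRestrict v)) (by rw [map_sub, h1, sub_self])
    rw [map_sub, sub_eq_zero] at this
    exact this
  rw [h2]
  refine (L.le_opNorm _).trans ?_
  have : ‖g.rangeRestrict v‖ = ‖g v‖ := rfl
  rw [this]
  gcongr
  linarith

/-- evaluation of a polynomial on Euclidean space -/
def pev (d : ℕ) (P : MvPolynomial (Fin d) ℝ) (x : EuclideanSpace ℝ (Fin d)) : ℝ :=
  MvPolynomial.eval (fun j => x j) P

theorem pev_cont (d : ℕ) (P : MvPolynomial (Fin d) ℝ) : Continuous (pev d P) :=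
  (aux_contDiff d P).continuous

theorem pev_mul (d : ℕ) (P Q : MvPolynomial (Fin d) ℝ) (x : EuclideanSpace ℝ (Fin d)) :
    pev d (P * Q) x = pev d P x * pev d Q x := by simp [pev]

theorem pev_memLp (d : ℕ) (T : Set (EuclideanSpace ℝ (Fin d)))
    (hb : Bornology.IsBounded T) (hT : IsOpen T) (P : MvPolynomial (Fin d) ℝ) :
    MemLp (pev d P) 2 (volume.restrict T) := by
  have hfin : IsFiniteMeasure (volume.restrict T) :=
    ⟨by rw [Measure.restrict_apply_univ]; exact hb.measure_lt_top⟩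
  obtain ⟨C, hC⟩ := hb.isCompact_closure.exists_bound_of_continuousOn (pev_cont d P).continuousOn
  refine MemLp.of_bound (pev_cont d P).aestronglyMeasurable C ?_
  filter_upwards [ae_restrict_mem hT.measurableSet] with x hx
  exact hC x (subset_closure hx)

theorem pev_integrable (d : ℕ) (T : Set (EuclideanSpace ℝ (Fin d)))
    (hb : Bornology.IsBounded T) (hT : IsOpen T) (P : MvPolynomial (Fin d) ℝ) :
    Integrable (pev d P) (volume.restrict T) := by
  have hfin : IsFiniteMeasure (volume.restrict T) :=
    ⟨by rw [Measure.restrict_apply_univ]; exact hb.measure_lt_top⟩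
  exact (pev_memLp d T hb hT P).integrable (by norm_num)

/-- the L2 class of `R * P` -/
def pL (d : ℕ) (T : Set (EuclideanSpace ℝ (Fin d)))
    (hb : Bornology.IsBounded T) (hT : IsOpen T) (R : MvPolynomial (Fin d) ℝ) :
    MvPolynomial (Fin d) ℝ →ₗ[ℝ] Lp ℝ 2 (volume.restrict T) where
  toFun P := (pev_memLp d T hb hT (R * P)).toLp _
  map_add' P Q := by
    rw [← MemLp.toLp_add]
    congr 1
    funext x
    simp [pev, mul_add]
  map_smul' c P := by
    rw [RingHom.id_apply, ← MemLp.toLp_const_smul]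
    congr 1
    funext x
    simp [pev]

theorem pL_inner (d : ℕ) (T : Set (EuclideanSpace ℝ (Fin d)))
    (hb : Bornology.IsBounded T) (hT : IsOpen T) (R S P Q : MvPolynomial (Fin d) ℝ) :
    ⟪pL d T hb hT R P, pL d T hb hT S Q⟫ = ∫ x in T, pev d (R * P) x * pev d (S * Q) x := by
  rw [L2.inner_def]
  apply integral_congr_ae
  filter_upwards [(pev_memLp d T hb hT (R * P)).coeFn_toLp, 
    (pev_memLp d T hb hT (S * Q)).coeFn_toLp] with x h1 h2
  simp only [pL, LinearMap.coe_mk, AddHom.coe_mk, h1, h2]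
  simp [mul_comm]

theorem pL_norm (d : ℕ) (T : Set (EuclideanSpace ℝ (Fin d)))
    (hb : Bornology.IsBounded T) (hT : IsOpen T) (P : MvPolynomial (Fin d) ℝ) :
    ‖pL d T hb hT 1 P‖ = Real.sqrt (∫ x in T, (pev d P x) ^ 2) := by
  rw [norm_eq_sqrt_real_inner, pL_inner]
  simp [sq]

theorem pL_eq_zero (d : ℕ) (T : Set (EuclideanSpace ℝ (Fin d)))
    (hb : Bornology.IsBounded T) (hT : IsOpen T) (R P : MvPolynomial (Fin d) ℝ) :
    pL d T hb hT R P = 0 ↔ ∀ᵐ x ∂(volume.restrict T), pev d R x * pev d P x = 0 := by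
  simp only [pL, LinearMap.coe_mk, AddHom.coe_mk]
  rw [← MemLp.toLp_zero (MemLp.zero (p := 2) (ε := ℝ) (μ := volume.restrict T)), MemLp.toLp_eq_toLp_iff]
  simp only [Filter.EventuallyEq, pev_mul, Pi.zero_apply]

open MvPolynomial in
/-- polynomial version of the operator -/
def pE (d : ℕ) (κ : Matrix (Fin d) (Fin d) ℝ) (P : MvPolynomial (Fin d) ℝ) :
    MvPolynomial (Fin d) ℝ := ∑ i, ∑ j, C (κ i j) * pderiv i (pderiv j P)

theorem Eop_pev (d : ℕ) (κ : Matrix (Fin d) (Fin d) ℝ) (P : MvPolynomial (Fin d) ℝ) :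
    Eop d κ (pev d P) = pev d (pE d κ P) := by
  funext x
  have h : ∀ i P, pder d i (pev d P) = pev d (MvPolynomial.pderiv i P) := fun i P => aux_pder d P i
  simp only [Eop, h]
  simp [pev, pE]

open MvPolynomial in
theorem pE_deg (d k : ℕ) (κ : Matrix (Fin d) (Fin d) ℝ) (P : MvPolynomial (Fin d) ℝ)
    (hP : P.totalDegree ≤ k) : (pE d κ P).totalDegree ≤ k - 2 := by
  refine totalDegree_finsetSum_le fun i _ => totalDegree_finsetSum_le fun j _ => ?_
  refine (totalDegree_mul _ _).trans ?_
  have h1 := aux_deg d P j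
  have h2 := aux_deg d (pderiv j P) i
  simp only [totalDegree_C]
  omega

open MvPolynomial in
theorem pE_zero (d : ℕ) (κ : Matrix (Fin d) (Fin d) ℝ) (P : MvPolynomial (Fin d) ℝ)
    (hP : P.totalDegree ≤ 1) : pE d κ P = 0 := by
  refine Finset.sum_eq_zero fun i _ => Finset.sum_eq_zero fun j _ => ?_
  have h1 := aux_deg d P j
  have h2 : (pderiv j P).totalDegree = 0 := by omega
  rw [totalDegree_eq_zero_iff_eq_C] at h2
  rw [h2]; simp

open MvPolynomial in
theorem pE_green (d : ℕ) (κ : Matrix (Fin d) (Fin d) ℝ) (hκ : ∀ i j, κ i j = κ j i) 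
    (P Q : MvPolynomial (Fin d) ℝ) :
    P * pE d κ Q - Q * pE d κ P = 
      ∑ i, pderiv i (∑ j, C (κ i j) * (P * pderiv j Q - Q * pderiv j P)) := by
  have hsym : ∑ i, ∑ j, C (κ i j) * (pderiv i P * pderiv j Q) = 
      ∑ i, ∑ j, C (κ i j) * (pderiv i Q * pderiv j P) := by
    rw [Finset.sum_comm]
    refine Finset.sum_congr rfl fun i _ => Finset.sum_congr rfl fun j _ => ?_
    rw [hκ]; ring
  rw [← sub_eq_zero] at hsym
  rw [← add_zero (P * pE d κ Q - _), ← hsym]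
  simp only [pE, Finset.mul_sum, map_sum, ← Finset.sum_sub_distrib, ← Finset.sum_add_distrib,
    map_sub, pderiv_mul, pderiv_C]
  refine Finset.sum_congr rfl fun i _ => Finset.sum_congr rfl fun j _ => ?_
  ring

theorem green (d : ℕ) (κ : Matrix (Fin d) (Fin d) ℝ) (hκ : ∀ i j, κ i j = κ j i)
    (T : Set (EuclideanSpace ℝ (Fin d))) (hT : IsOpen T)
    (hb : Bornology.IsBounded T) (hnull : volume (frontier T) = 0)
    (P Q : MvPolynomial (Fin d) ℝ) (h0 : ∀ x ∈ frontier T, pev d Q x = 0)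
    (h1 : ∀ x ∈ frontier T, ∀ j, pev d (MvPolynomial.pderiv j Q) x = 0) :
    ∫ x in T, pev d P x * pev d (pE d κ Q) x = ∫ x in T, pev d Q x * pev d (pE d κ P) x := by
  rw [← sub_eq_zero, ← integral_sub]
  rotate_left
  · simpa only [← pev_mul] using pev_integrable d T hb hT _
  · simpa only [← pev_mul] using pev_integrable d T hb hT _
  have : ∀ x, pev d P x * pev d (pE d κ Q) x - pev d Q x * pev d (pE d κ P) x = 
      ∑ i, pev d (MvPolynomial.pderiv i (∑ j, MvPolynomial.C (κ i j) * 
        (P * MvPolynomial.pderiv j Q - Q * MvPolynomial.pderiv j P))) x := by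
    intro x
    have := congrArg (fun R => pev d R x) (pE_green d κ hκ P Q)
    simpa only [pev, map_sub, map_mul, map_sum] using this
  simp only [this]
  rw [integral_finsetSum _ (fun i _ => pev_integrable d T hb hT _)]
  refine Finset.sum_eq_zero fun i _ => ?_
  have h := aux_div d T hT hb hnull _ (aux_contDiff d (∑ j, MvPolynomial.C (κ i j) * 
        (P * MvPolynomial.pderiv j Q - Q * MvPolynomial.pderiv j P))) ?_ 
        (EuclideanSpace.single i (1 : ℝ))
  · rw [← h]
    congr 1
    funext x
    exact (congrFun (aux_pder d _ i) x).symm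
  · intro x hx
    have h0 := h0 x hx
    have h1 := h1 x hx
    simp only [pev] at h0 h1
    simp [h0, h1]

/-- Lemma 3.1: stabilizer-free lower bound for `E_w`. -/
theorem stmt1 (d N : ℕ) (hd : 2 ≤ d) (hN : 1 ≤ N)
    (T : Set (EuclideanSpace ℝ (Fin d))) (hTopen : IsOpen T) (hTne : T.Nonempty)
    (hTbdd : Bornology.IsBounded T)
    (e : Fin N → Set (EuclideanSpace ℝ (Fin d)))
    (A n : Fin N → EuclideanSpace ℝ (Fin d)) (hn : ∀ i, ‖n i‖ = 1)
    (he_cpt : ∀ i, IsCompact (e i))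
    (he_sub : ∀ i, e i ⊆ {x | ⟪x - A i, n i⟫ = 0})
    (he_pos : ∀ i, 0 < μH[((d : ℝ) - 1)] (e i))
    (hbd : frontier T = ⋃ i, e i)
    (κ : Matrix (Fin d) (Fin d) ℝ) (hκ : κ.PosDef)
    (k : ℕ) (hk : 1 ≤ k) :
    ∃ C > (0 : ℝ), ∀ (v₀ : EuclideanSpace ℝ (Fin d) → ℝ)
      (vb vg : Fin N → EuclideanSpace ℝ (Fin d) → ℝ)
      (w : EuclideanSpace ℝ (Fin d) → ℝ),
      IsPolyDeg d k v₀ → (∀ i, IsPolyDeg d k (vb i)) → (∀ i, IsPolyDeg d (k - 1) (vg i)) →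
      IsPolyDeg d (2 * N + k - 2) w →
      (∀ φ : EuclideanSpace ℝ (Fin d) → ℝ, IsPolyDeg d (2 * N + k - 2) φ →
        ∫ x in T, w x * φ x =
          (∫ x in T, v₀ x * Eop d κ φ x)
          - ∑ i, ∫ x in e i, vb i x * kGradDot d κ φ (n i) x ∂μH[((d : ℝ) - 1)]
          + ∑ i, ∫ x in e i, vg i x * φ x ∂μH[((d : ℝ) - 1)]) →
      Real.sqrt (∫ x in T, (Eop d κ v₀ x) ^ 2) ≤ C * Real.sqrt (∫ x in T, (w x) ^ 2) := by
  classical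
  have hκs : ∀ i j, κ i j = κ j i := fun i j => by
    have := hκ.isHermitian.apply i j
    simpa using this.symm
  have hnull : volume (frontier T) = 0 := by
    rw [hbd]
    exact measure_iUnion_null fun i => measure_mono_null (he_sub i) (aux_hyper d _ _ (hn i))
  let l : Fin N → MvPolynomial (Fin d) ℝ := fun i =>
    ∑ j, MvPolynomial.C (n i j) * (MvPolynomial.X j - MvPolynomial.C (A i j))
  have hl : ∀ i x, pev d (l i) x = ⟪x - A i, n i⟫ := by
    intro i x
    simp [pev, l, PiLp.inner_apply]
  have hldeg : ∀ i, (l i).totalDegree ≤ 1 := by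
    intro i
    refine MvPolynomial.totalDegree_finsetSum_le fun j _ => ?_
    refine (MvPolynomial.totalDegree_mul _ _).trans ?_
    have := MvPolynomial.totalDegree_sub_C_le (MvPolynomial.X j : MvPolynomial (Fin d) ℝ) (A i j)
    simpa using this
  let B : MvPolynomial (Fin d) ℝ := ∏ i, l i
  have hBdeg : B.totalDegree ≤ N := by
    refine (MvPolynomial.totalDegree_finsetProd _ _).trans ?_
    refine (Finset.sum_le_sum fun i _ => hldeg i).trans ?_
    simp
  have hBev : ∀ x, pev d B x = ∏ i, ⟪x - A i, n i⟫ := by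
    intro x
    simp only [← hl]
    simp [pev, B]
  have hBe : ∀ i, ∀ x ∈ e i, pev d B x = 0 := by
    intro i x hx
    rw [hBev]
    exact Finset.prod_eq_zero (Finset.mem_univ i) (he_sub i hx)
  have hBae : ∀ᵐ x ∂(volume.restrict T), pev d B x ≠ 0 := by
    apply ae_restrict_of_ae
    have : ∀ i, ∀ᵐ x ∂(volume : Measure (EuclideanSpace ℝ (Fin d))), ⟪x - A i, n i⟫ ≠ 0 :=
      fun i => measure_eq_zero_iff_ae_notMem.1 (aux_hyper d (A i) (n i) (hn i))
    filter_upwards [ae_all_iff.2 this] with x hx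
    rw [hBev]
    exact Finset.prod_ne_zero_iff.2 fun i _ => hx i
  let V := MvPolynomial.restrictTotalDegree (Fin d) ℝ k
  let L := fun R => (pL d T hTbdd hTopen R).comp V.subtype
  obtain ⟨C1, hC1, h1⟩ := aux_fin (L 1) (L B) (by
    intro v hv
    simp only [L, LinearMap.comp_apply, pL_eq_zero] at hv ⊢
    filter_upwards [hv, hBae] with x h1 h2
    rw [(mul_eq_zero.1 h1).resolve_left h2, mul_zero])
  obtain ⟨C2, hC2, h2⟩ := aux_fin (L (B * B)) (L B) (by
    intro v hv
    simp only [L, LinearMap.comp_apply, pL_eq_zero] at hv ⊢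
    filter_upwards [hv] with x h1
    rw [pev_mul, mul_assoc, h1, mul_zero])
  refine ⟨C1 * C2, by positivity, ?_⟩
  intro v₀ vb vg w ⟨P, hPdeg, hP⟩ _ _ ⟨W, hWdeg, hW⟩ hweak
  obtain rfl : v₀ = pev d P := funext hP
  obtain rfl : w = pev d W := funext hW
  clear hP hW
  rw [Eop_pev]
  by_cases hk1 : k = 1
  · rw [pE_zero d κ P (by omega)]
    simp only [pev, map_zero]
    simp
    positivity
  have hqdeg := pE_deg d k κ P hPdeg
  set q := pE d κ P with hq
  let Φ := B * B * q
  have hΦdeg : Φ.totalDegree ≤ 2 * N + k - 2 := by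
    have a1 := MvPolynomial.totalDegree_mul (B * B) q
    have a2 := MvPolynomial.totalDegree_mul B B
    change (B * B * q).totalDegree ≤ _
    omega
  have hΦe : ∀ i, ∀ x ∈ e i, pev d Φ x = 0 := by
    intro i x hx
    simp [Φ, pev_mul, hBe i x hx]
  have hΦe' : ∀ i, ∀ x ∈ e i, ∀ j, pev d (MvPolynomial.pderiv j Φ) x = 0 := by
    intro i x hx j
    have := hBe i x hx
    simp only [pev] at this
    simp [Φ, pev, MvPolynomial.pderiv_mul, this]
  have hw := hweak (pev d Φ) ⟨Φ, hΦdeg, fun _ => rfl⟩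
  have z1 : ∀ i, ∫ x in e i, vb i x * kGradDot d κ (pev d Φ) (n i) x ∂μH[((d : ℝ) - 1)] = 0 := by
    intro i
    rw [setIntegral_congr_fun (g := fun _ => (0:ℝ)) (he_cpt i).measurableSet]
    · simp
    intro x hx
    have h : ∀ b, pder d b (pev d Φ) x = 0 := fun b =>
      (congrFun (aux_pder d Φ b) x).trans (hΦe' i x hx b)
    simp [kGradDot, h]
  have z2 : ∀ i, ∫ x in e i, vg i x * pev d Φ x ∂μH[((d : ℝ) - 1)] = 0 := by
    intro i
    rw [setIntegral_congr_fun (g := fun _ => (0:ℝ)) (he_cpt i).measurableSet]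
    · simp
    intro x hx
    simp [hΦe i x hx]
  simp only [z1, z2, Finset.sum_const_zero, sub_zero, add_zero, Eop_pev] at hw
  rw [green d κ hκs T hTopen hTbdd hnull P Φ
    (fun x hx => by
      rw [hbd] at hx
      obtain ⟨i, hi⟩ := Set.mem_iUnion.1 hx
      exact hΦe i x hi)
    (fun x hx => by
      rw [hbd] at hx
      obtain ⟨i, hi⟩ := Set.mem_iUnion.1 hx
      exact hΦe' i x hi)] at hw
  rw [← pL_norm d T hTbdd hTopen, ← pL_norm d T hTbdd hTopen]
  let qv : V := ⟨q, (MvPolynomial.mem_restrictTotalDegree _ _ _).2 (by omega)⟩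
  have h1 : ‖pL d T hTbdd hTopen 1 q‖ ≤ C1 * ‖pL d T hTbdd hTopen B q‖ := h1 qv
  have h2 : ‖pL d T hTbdd hTopen (B * B) q‖ ≤ C2 * ‖pL d T hTbdd hTopen B q‖ := h2 qv
  have hsq : ‖pL d T hTbdd hTopen B q‖ ^ 2 =
      ⟪pL d T hTbdd hTopen 1 W, pL d T hTbdd hTopen (B * B) q⟫ := by
    rw [← real_inner_self_eq_norm_sq, pL_inner, pL_inner, one_mul]
    refine Eq.trans ?_ hw.symm
    congr 1
    funext x
    simp only [Φ, pev_mul]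
    ring
  have hcs := real_inner_le_norm (pL d T hTbdd hTopen 1 W) (pL d T hTbdd hTopen (B * B) q)
  rw [← hsq] at hcs
  have hb : ‖pL d T hTbdd hTopen B q‖ ≤ C2 * ‖pL d T hTbdd hTopen 1 W‖ := by
    rcases (norm_nonneg (pL d T hTbdd hTopen B q)).eq_or_lt with h | h
    · rw [← h]; positivity
    · refine le_of_mul_le_mul_right ?_ h
      have := mul_le_mul_of_nonneg_left h2 (norm_nonneg (pL d T hTbdd hTopen 1 W))
      nlinarith
  calc _ ≤ _ := h1
    _ ≤ C1 * (C2 * ‖pL d T hTbdd hTopen 1 W‖) := by gcongr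
    _ = _ := by ring
end
end

section
/- Lemma 3.2 (lower bound for the weak gradient): Let k ≥ 1 and r₂ = 2N + k − 1. There exists a constant C > 0 such that for every discrete weak function v = (v₀, (v_{b,i}), (v_{g,i})) of order k on T and every vector polynomial G ∈ (P_{r₂})^d satisfying ∫_T G·ψ dx = −∫_T v₀ (∇·ψ) dx + Σ_{i=1}^N ∫_{e_i} v_{b,i} ψ·n_i dH^{d−1} for all ψ ∈ (P_{r₂})^d, one has ‖∇v₀‖_{L²(T)} ≤ C ‖G‖_{L²(T)}. -/
open MeasureTheory RealInnerProductSpace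
open scoped BigOperators

noncomputable section

/-- evaluation of a polynomial on Euclidean space -/
def evP {d : ℕ} (P : MvPolynomial (Fin d) ℝ) : EuclideanSpace ℝ (Fin d) → ℝ :=
  fun x => MvPolynomial.eval (fun j => x j) P

theorem evP_cont {d : ℕ} (P : MvPolynomial (Fin d) ℝ) : Continuous (evP P) := by
  unfold evP
  exact (MvPolynomial.continuous_eval P).comp (by fun_prop)

theorem evP_hasFDeriv {d : ℕ} (P : MvPolynomial (Fin d) ℝ) (x : EuclideanSpace ℝ (Fin d)) :
    HasFDerivAt (evP P) (∑ j, evP (MvPolynomial.pderiv j P) x •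
      (EuclideanSpace.proj j : EuclideanSpace ℝ (Fin d) →L[ℝ] ℝ)) x := by
  induction P using MvPolynomial.induction_on with
  | C a =>
    have h : evP (MvPolynomial.C a : MvPolynomial (Fin d) ℝ) = fun _ => a := by
      funext y; simp [evP]
    rw [h]
    refine (hasFDerivAt_const a x).congr_fderiv ?_
    simp [evP]
  | add p q hp hq =>
    have h : evP (p + q) = fun y => evP p y + evP q y := by
      funext y; simp [evP]
    rw [h]
    refine (hp.add hq).congr_fderiv ?_
    rw [← Finset.sum_add_distrib]
    refine Finset.sum_congr rfl fun j _ => ?_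
    rw [← add_smul]; simp [evP]
  | mul_X p i hp =>
    have h : evP (p * MvPolynomial.X i) = fun y => evP p y * y i := by
      funext y; simp [evP]
    rw [h]
    have h2 : HasFDerivAt (fun y : EuclideanSpace ℝ (Fin d) => y i)
      (EuclideanSpace.proj i : EuclideanSpace ℝ (Fin d) →L[ℝ] ℝ) x :=
      (EuclideanSpace.proj i : EuclideanSpace ℝ (Fin d) →L[ℝ] ℝ).hasFDerivAt
    refine (hp.mul h2).congr_fderiv ?_
    symm
    ext y
    simp [evP, MvPolynomial.pderiv_X, Pi.single_apply, Finset.sum_add_distrib, add_mul,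
      Finset.mul_sum, apply_ite, ite_apply]
    refine Finset.sum_congr rfl fun j _ => by ring

theorem pder_evP {d : ℕ} (P : MvPolynomial (Fin d) ℝ) (j : Fin d) :
    pder d j (evP P) = evP (MvPolynomial.pderiv j P) := by
  funext x
  unfold pder
  rw [(evP_hasFDeriv P x).fderiv]
  simp [ContinuousLinearMap.sum_apply, Pi.single_apply]

theorem pderiv_deg {d : ℕ} (P : MvPolynomial (Fin d) ℝ) (i : Fin d) :
    (MvPolynomial.pderiv i P).totalDegree ≤ P.totalDegree - 1 := by
  unfold MvPolynomial.totalDegree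
  refine Finset.sup_le fun m hm => ?_
  rw [MvPolynomial.mem_support_iff, MvPolynomial.coeff_pderiv] at hm
  have h : m + Finsupp.single i 1 ∈ P.support := by
    rw [MvPolynomial.mem_support_iff]
    exact left_ne_zero_of_mul hm
  have h2 := MvPolynomial.le_totalDegree h
  rw [Finsupp.sum_add_index' (by simp) (by simp)] at h2
  simp at h2
  unfold MvPolynomial.totalDegree at h2
  omega

theorem evP_zero_of_open {d : ℕ} (P : MvPolynomial (Fin d) ℝ)
    (T : Set (EuclideanSpace ℝ (Fin d))) (hT : IsOpen T) (hne : T.Nonempty)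
    (h : ∀ x ∈ T, evP P x = 0) : P = 0 := by
  obtain ⟨x0, hx0⟩ := hne
  have hc : Continuous (fun y : Fin d → ℝ => (WithLp.toLp 2 y : EuclideanSpace ℝ (Fin d))) := by
    fun_prop
  have ho := hT.preimage hc
  obtain ⟨ε, hε, hb⟩ := Metric.isOpen_iff.1 ho (fun j => x0 j) hx0
  refine MvPolynomial.funext_set (fun i => Metric.ball (x0 i) ε) ?_ ?_
  · intro i
    rw [Real.ball_eq_Ioo]
    exact Set.Ioo_infinite (by linarith)
  · intro y hy
    rw [← ball_pi _ hε] at hy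
    have := h _ (hb hy)
    simpa [evP] using this

theorem int_on {d : ℕ} (T : Set (EuclideanSpace ℝ (Fin d))) (hTb : Bornology.IsBounded T)
    (f : EuclideanSpace ℝ (Fin d) → ℝ) (hf : Continuous f) : IntegrableOn f T := by
  have hK : IsCompact (closure T) := hTb.isCompact_closure
  exact (hf.continuousOn.integrableOn_compact hK).mono_set subset_closure

theorem norm_equiv {d : ℕ} (T : Set (EuclideanSpace ℝ (Fin d))) (hT : IsOpen T)
    (hne : T.Nonempty) (hTb : Bornology.IsBounded T) (b : MvPolynomial (Fin d) ℝ) (hb : b ≠ 0)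
    (r : ℕ) : ∃ c > (0 : ℝ), ∀ P : MvPolynomial (Fin d) ℝ, P.totalDegree ≤ r →
      ∫ x in T, evP P x ^ 2 ≤ c * ∫ x in T, evP b x ^ 2 * evP P x ^ 2 := by
  have hK : IsCompact (closure T) := hTb.isCompact_closure
  let V := MvPolynomial.restrictTotalDegree (Fin d) ℝ r
  obtain ⟨n, ⟨B⟩⟩ : ∃ n : ℕ, Nonempty (Module.Basis (Fin n) ℝ V) :=
    ⟨_, ⟨Module.finBasis ℝ V⟩⟩
  let p : (Fin n → ℝ) → MvPolynomial (Fin d) ℝ := fun c => (B.equivFun.symm c : V)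
  have hp_ev : ∀ c x, evP (p c) x = ∑ i, c i * evP (B i : MvPolynomial (Fin d) ℝ) x := by
    intro c x
    simp only [p, Module.Basis.equivFun_symm_apply, evP, Submodule.coe_sum, Submodule.coe_smul,
      map_sum, MvPolynomial.smul_eval]
  have hp_inj : ∀ c, p c = 0 → c = 0 := by
    intro c hc
    have : B.equivFun.symm c = 0 := Subtype.ext hc
    exact B.equivFun.symm.map_eq_zero_iff.1 this
  have hcontp : Continuous (fun z : (Fin n → ℝ) × EuclideanSpace ℝ (Fin d) => evP (p z.1) z.2) := by
    simp only [hp_ev]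
    refine continuous_finsetSum _ fun i _ => ?_
    exact ((continuous_apply i).comp continuous_fst).mul ((evP_cont _).comp continuous_snd)
  have key : ∀ w : EuclideanSpace ℝ (Fin d) → ℝ, Continuous w →
      Continuous (fun c => ∫ x in T, w x * evP (p c) x ^ 2) := by
    intro w hw
    have h := continuous_parametric_integral_of_continuous (μ := volume.restrict T)
      (f := fun c x => w x * evP (p c) x ^ 2) ?_ hK
    · rw [Measure.restrict_restrict hK.measurableSet,
        Set.inter_eq_right.2 subset_closure] at h
      exact h
    · exact (hw.comp continuous_snd).mul (hcontp.pow 2)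
  have hq1 := key (fun _ => 1) continuous_const
  have hqb := key (fun x => evP b x ^ 2) ((evP_cont b).pow 2)
  set q1 := fun c => ∫ x in T, (1:ℝ) * evP (p c) x ^ 2 with hq1d
  set qb := fun c => ∫ x in T, evP b x ^ 2 * evP (p c) x ^ 2 with hqbd
  have hpos : ∀ c, c ≠ 0 → 0 < qb c := by
    intro c hc
    have h0 : 0 ≤ qb c := integral_nonneg fun x => by positivity
    refine lt_of_le_of_ne h0 fun h => hc (hp_inj c ?_)
    have hcont : Continuous fun x => evP b x ^ 2 * evP (p c) x ^ 2 :=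
      ((evP_cont b).pow 2).mul ((evP_cont _).pow 2)
    have h1 := (setIntegral_eq_zero_iff_of_nonneg_ae
      (Filter.Eventually.of_forall fun x => by simp only [Pi.zero_apply]; positivity)
      (int_on T hTb _ hcont)).1 h.symm
    have h2 := Measure.eqOn_open_of_ae_eq h1 hT hcont.continuousOn continuousOn_const
    have h3 : b * p c = 0 := by
      refine evP_zero_of_open _ T hT hne fun x hx => ?_
      have := h2 hx
      simp only [Pi.zero_apply] at this
      rw [← mul_pow] at this
      have h4 := pow_eq_zero_iff (two_ne_zero) |>.1 this
      simpa [evP] using h4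
    exact (mul_eq_zero.1 h3).resolve_left hb
  have hscale : ∀ (w : EuclideanSpace ℝ (Fin d) → ℝ) (t : ℝ) c,
      ∫ x in T, w x * evP (p (t • c)) x ^ 2 = t ^ 2 * ∫ x in T, w x * evP (p c) x ^ 2 := by
    intro w t c
    rw [← integral_const_mul]
    congr 1; funext x
    have : evP (p (t • c)) x = t * evP (p c) x := by
      simp only [hp_ev, Finset.mul_sum, Pi.smul_apply, smul_eq_mul, mul_assoc]
    rw [this]; ring
  have hS : IsCompact (Metric.sphere (0 : Fin n → ℝ) 1) := isCompact_sphere _ _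
  obtain ⟨C, hC⟩ : ∃ C, ∀ c ∈ Metric.sphere (0 : Fin n → ℝ) 1, q1 c / qb c ≤ C := by
    have hcd : ContinuousOn (fun c => q1 c / qb c) (Metric.sphere (0 : Fin n → ℝ) 1) := by
      refine hq1.continuousOn.div hqb.continuousOn fun c hc => (hpos c ?_).ne'
      rintro rfl; simp at hc
    obtain ⟨C, hC⟩ := hS.bddAbove_image hcd
    exact ⟨C, fun c hc => hC ⟨c, hc, rfl⟩⟩
  refine ⟨max C 1, by positivity, fun P hP => ?_⟩
  obtain ⟨c, hc⟩ : ∃ c, p c = P := by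
    refine ⟨B.equivFun ⟨P, (MvPolynomial.mem_restrictTotalDegree _ _ _).2 hP⟩, ?_⟩
    simp only [p, LinearEquiv.symm_apply_apply]
  subst hc
  have hnn : 0 ≤ qb c := integral_nonneg fun x => by positivity
  suffices h : q1 c ≤ C * qb c by
    have h' : q1 c ≤ max C 1 * qb c :=
      h.trans (mul_le_mul_of_nonneg_right (le_max_left _ _) hnn)
    simpa [q1, qb] using h'
  by_cases hc0 : c = 0
  · subst hc0
    have hp0 : p 0 = 0 := by simp [p]
    simp [q1, qb, hp0, evP]
  · have hnc : ‖c‖ ≠ 0 := by simpa using hc0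
    have hu : ‖c‖⁻¹ • c ∈ Metric.sphere (0 : Fin n → ℝ) 1 := by
      simp [norm_smul, hnc]
    have h := hC _ hu
    have hune : ‖c‖⁻¹ • c ≠ 0 := by rintro h; rw [h] at hu; simp at hu
    rw [div_le_iff₀ (hpos _ hune)] at h
    have e1 : q1 (‖c‖⁻¹ • c) = ‖c‖⁻¹ ^ 2 * q1 c := hscale _ _ _
    have e2 : qb (‖c‖⁻¹ • c) = ‖c‖⁻¹ ^ 2 * qb c := hscale _ _ _
    rw [e1, e2] at h
    have hp2 : 0 < ‖c‖⁻¹ ^ 2 := by positivity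
    nlinarith

theorem ibp {d : ℕ} (T : Set (EuclideanSpace ℝ (Fin d))) (hT : IsOpen T)
    (hTb : Bornology.IsBounded T) (b Q : MvPolynomial (Fin d) ℝ)
    (hb : ∀ x ∈ frontier T, evP b x = 0) (j : Fin d) :
    ∫ x in T, evP (MvPolynomial.pderiv j (b ^ 2 * Q)) x = 0 := by
  set F := b ^ 2 * Q with hF
  let F' : EuclideanSpace ℝ (Fin d) → (EuclideanSpace ℝ (Fin d) →L[ℝ] ℝ) := fun x =>
    ∑ j, evP (MvPolynomial.pderiv j F) x •
      (EuclideanSpace.proj j : EuclideanSpace ℝ (Fin d) →L[ℝ] ℝ)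
  have hfr : ∀ x ∈ frontier T, evP F x = 0 ∧ F' x = 0 := by
    intro x hx
    have h0 := hb x hx
    unfold evP at h0
    refine ⟨by simp [evP, hF, h0], ?_⟩
    refine Finset.sum_eq_zero fun j _ => ?_
    have : evP (MvPolynomial.pderiv j F) x = 0 := by
      simp [evP, hF, MvPolynomial.pderiv_mul, MvPolynomial.pderiv_pow, h0]
    rw [this, zero_smul]
  have hder : ∀ x, HasFDerivAt (T.indicator (evP F)) (T.indicator F' x) x := by
    intro x
    by_cases hx : x ∈ T
    · rw [Set.indicator_of_mem hx]
      refine (evP_hasFDeriv F x).congr_of_eventuallyEq ?_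
      filter_upwards [hT.mem_nhds hx] with y hy
      rw [Set.indicator_of_mem hy]
    · rw [Set.indicator_of_notMem hx]
      by_cases hxc : x ∈ closure T
      · have hxf : x ∈ frontier T := ⟨hxc, by rwa [hT.interior_eq]⟩
        obtain ⟨h0, h1⟩ := hfr x hxf
        have hd : HasFDerivAt (evP F) (F' x) x := evP_hasFDeriv F x
        rw [h1, hasFDerivAt_iff_isLittleO] at hd
        rw [hasFDerivAt_iff_isLittleO]
        refine Asymptotics.IsBigO.trans_isLittleO ?_ hd
        refine Asymptotics.IsBigO.of_bound 1 (Filter.Eventually.of_forall fun y => ?_)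
        rw [Set.indicator_of_notMem hx, h0]
        by_cases hy : y ∈ T
        · simp [hy]
        · simp [hy]
      · refine (hasFDerivAt_const (0:ℝ) x).congr_of_eventuallyEq ?_
        filter_upwards [isClosed_closure.isOpen_compl.mem_nhds hxc] with y hy
        exact Set.indicator_of_notMem (fun h => hy (subset_closure h)) _
  let v : EuclideanSpace ℝ (Fin d) := EuclideanSpace.single j 1
  have hv : ∀ x, T.indicator F' x v = T.indicator (evP (MvPolynomial.pderiv j F)) x := by
    intro x
    by_cases hx : x ∈ T
    · simp [hx, F', v, ContinuousLinearMap.sum_apply, Pi.single_apply]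
    · simp [hx]
  have hi1 : Integrable (T.indicator (evP (MvPolynomial.pderiv j F))) :=
    (integrable_indicator_iff hT.measurableSet).2 (int_on T hTb _ (evP_cont _))
  have hi2 : Integrable (T.indicator (evP F)) :=
    (integrable_indicator_iff hT.measurableSet).2 (int_on T hTb _ (evP_cont _))
  have h := integral_bilinear_hasFDerivAt_right_eq_neg_left_of_integrable
    (μ := (volume : Measure (EuclideanSpace ℝ (Fin d))))
    (f := T.indicator (evP F)) (f' := T.indicator F') (g := fun _ => (1:ℝ)) (g' := fun _ => 0)
    (v := v) (B := ContinuousLinearMap.mul ℝ ℝ) (by simpa [hv] using hi1) (by simp)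
    (by simpa using hi2) (fun x _ => hder x) (fun x _ => hasFDerivAt_const _ _)
  simp [hv] at h
  rwa [integral_indicator hT.measurableSet] at h

/-- the affine polynomial of a hyperplane -/
def lpoly {d : ℕ} (A n : EuclideanSpace ℝ (Fin d)) : MvPolynomial (Fin d) ℝ :=
  ∑ j, MvPolynomial.C (n j) * (MvPolynomial.X j - MvPolynomial.C (A j))

theorem lpoly_ev {d : ℕ} (A n x : EuclideanSpace ℝ (Fin d)) :
    evP (lpoly A n) x = ⟪x - A, n⟫ := by
  simp [evP, lpoly, PiLp.inner_apply]

theorem lpoly_ne {d : ℕ} (A n : EuclideanSpace ℝ (Fin d)) (hn : ‖n‖ = 1) : lpoly A n ≠ 0 := by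
  intro h
  have := lpoly_ev A n (A + n)
  rw [h] at this
  simp [evP, hn] at this

theorem lpoly_deg {d : ℕ} (A n : EuclideanSpace ℝ (Fin d)) : (lpoly A n).totalDegree ≤ 1 := by
  refine (MvPolynomial.totalDegree_finsetSum _ _).trans (Finset.sup_le fun j _ => ?_)
  refine (MvPolynomial.totalDegree_mul _ _).trans ?_
  have := MvPolynomial.totalDegree_sub (MvPolynomial.X j : MvPolynomial (Fin d) ℝ)
    (MvPolynomial.C (A j))
  simp at this ⊢
  exact this

theorem young (M s u w : ℝ) (h : s ^ 2 ≤ M) :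
    2 * (u * (s ^ 2 * w)) ≤ s ^ 2 * w ^ 2 + M * u ^ 2 := by
  have h2 := mul_le_mul_of_nonneg_right h (sq_nonneg u)
  nlinarith [mul_nonneg (sq_nonneg s) (sq_nonneg (u - w))]

set_option maxHeartbeats 1000000

/-- Lemma 3.2: lower bound for the weak gradient. -/
theorem stmt2 (d N : ℕ) (hd : 2 ≤ d) (hN : 1 ≤ N)
    (T : Set (EuclideanSpace ℝ (Fin d))) (hTopen : IsOpen T) (hTne : T.Nonempty)
    (hTbdd : Bornology.IsBounded T)
    (e : Fin N → Set (EuclideanSpace ℝ (Fin d)))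
    (A n : Fin N → EuclideanSpace ℝ (Fin d)) (hn : ∀ i, ‖n i‖ = 1)
    (he_cpt : ∀ i, IsCompact (e i))
    (he_sub : ∀ i, e i ⊆ {x | ⟪x - A i, n i⟫ = 0})
    (he_pos : ∀ i, 0 < μH[((d : ℝ) - 1)] (e i))
    (hbd : frontier T = ⋃ i, e i)
    (k : ℕ) (hk : 1 ≤ k) :
    ∃ C > (0 : ℝ), ∀ (v₀ : EuclideanSpace ℝ (Fin d) → ℝ)
      (vb vg : Fin N → EuclideanSpace ℝ (Fin d) → ℝ)
      (G : Fin d → EuclideanSpace ℝ (Fin d) → ℝ),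
      IsPolyDeg d k v₀ → (∀ i, IsPolyDeg d k (vb i)) → (∀ i, IsPolyDeg d (k - 1) (vg i)) →
      (∀ j, IsPolyDeg d (2 * N + k - 1) (G j)) →
      (∀ ψ : Fin d → EuclideanSpace ℝ (Fin d) → ℝ, (∀ j, IsPolyDeg d (2 * N + k - 1) (ψ j)) →
        ∫ x in T, ∑ j, G j x * ψ j x =
          -(∫ x in T, v₀ x * ∑ j, pder d j (ψ j) x)
          + ∑ i, ∫ x in e i, vb i x * (∑ j, ψ j x * n i j) ∂μH[((d : ℝ) - 1)]) →
      Real.sqrt (∫ x in T, ∑ j, (pder d j v₀ x) ^ 2) ≤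
        C * Real.sqrt (∫ x in T, ∑ j, (G j x) ^ 2) := by
  set b : MvPolynomial (Fin d) ℝ := ∏ i, lpoly (A i) (n i) with hbdef
  have hb0 : b ≠ 0 := Finset.prod_ne_zero_iff.2 fun i _ => lpoly_ne _ _ (hn i)
  have hbdeg : b.totalDegree ≤ N := by
    refine (MvPolynomial.totalDegree_finsetProd _ _).trans ?_
    refine (Finset.sum_le_sum fun i _ => lpoly_deg (A i) (n i)).trans ?_
    simp
  have hbe : ∀ i, ∀ x ∈ e i, evP b x = 0 := by
    intro i x hx
    have h1 : evP b x = ∏ i, evP (lpoly (A i) (n i)) x := by simp [evP, hbdef, map_prod]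
    rw [h1]
    refine Finset.prod_eq_zero (Finset.mem_univ i) ?_
    rw [lpoly_ev]
    exact he_sub i hx
  have hbfr : ∀ x ∈ frontier T, evP b x = 0 := by
    intro x hx
    rw [hbd] at hx
    obtain ⟨i, hi⟩ := Set.mem_iUnion.1 hx
    exact hbe i x hi
  obtain ⟨c, hc, hceq⟩ := norm_equiv T hTopen hTne hTbdd b hb0 k
  obtain ⟨M, hM⟩ : ∃ M, ∀ x ∈ T, evP b x ^ 2 ≤ M := by
    obtain ⟨M, hM⟩ := hTbdd.isCompact_closure.bddAbove_image
      (((evP_cont b).pow 2).continuousOn (s := closure T))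
    exact ⟨M, fun x hx => hM ⟨x, subset_closure hx, rfl⟩⟩
  refine ⟨Real.sqrt (c * M) + 1, by positivity, ?_⟩
  intro v₀ vb vg G hv₀ _ _ hG hweak
  obtain ⟨P, hPdeg, hP⟩ := hv₀
  obtain rfl : v₀ = evP P := funext hP
  choose g hgdeg hg using hG
  obtain rfl : G = fun j => evP (g j) := funext fun j => funext (hg j)
  have hgc : ∀ j, Continuous (evP (g j)) := fun j => evP_cont _
  have hbc := evP_cont b
  simp only [pder_evP] at *
  have hpc : ∀ j, Continuous (evP (MvPolynomial.pderiv j P)) := fun j => evP_cont _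
  have hw := hweak (fun j => evP (b ^ 2 * MvPolynomial.pderiv j P)) (fun j => ⟨_, ?_, fun x => rfl⟩)
  swap
  · have h1 := MvPolynomial.totalDegree_mul (b ^ 2) (MvPolynomial.pderiv j P)
    have h2 := MvPolynomial.totalDegree_pow b 2
    have h3 := pderiv_deg P j
    omega
  have hface : ∀ i, ∫ x in e i, vb i x * (∑ j, evP (b ^ 2 * MvPolynomial.pderiv j P) x * n i j)
      ∂μH[((d : ℝ) - 1)] = 0 := by
    intro i
    refine setIntegral_eq_zero_of_forall_eq_zero fun x hx => ?_
    have h0 := hbe i x hx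
    unfold evP at h0
    simp [evP, h0]
  simp only [hface, pder_evP, Finset.sum_const_zero, add_zero] at hw
  have hvol : -(∫ x in T, evP P x * ∑ j, evP (MvPolynomial.pderiv j (b ^ 2 * MvPolynomial.pderiv j P)) x)
      = ∫ x in T, ∑ j, evP b x ^ 2 * evP (MvPolynomial.pderiv j P) x ^ 2 := by
    have hsum : ∫ x in T, ∑ j, evP (MvPolynomial.pderiv j (b ^ 2 * (MvPolynomial.pderiv j P * P))) x
        = 0 := by
      rw [integral_finsetSum _ fun j _ => int_on T hTbdd _ (evP_cont _)]
      exact Finset.sum_eq_zero fun j _ => ibp T hTopen hTbdd b _ hbfr j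
    have hsplit : ∀ x, ∑ j, evP (MvPolynomial.pderiv j (b ^ 2 * (MvPolynomial.pderiv j P * P))) x
        = evP P x * (∑ j, evP (MvPolynomial.pderiv j (b ^ 2 * MvPolynomial.pderiv j P)) x)
          + ∑ j, evP b x ^ 2 * evP (MvPolynomial.pderiv j P) x ^ 2 := by
      intro x
      rw [Finset.mul_sum, ← Finset.sum_add_distrib]
      refine Finset.sum_congr rfl fun j _ => ?_
      rw [← mul_assoc, MvPolynomial.pderiv_mul]
      simp only [evP, map_add, map_mul, map_pow]
      ring
    simp only [hsplit] at hsum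
    rw [integral_add] at hsum
    · linarith
    · exact int_on T hTbdd _ ((evP_cont _).mul (continuous_finsetSum _ fun j _ => evP_cont _))
    · exact int_on T hTbdd _ (by fun_prop)
  rw [hvol] at hw
  set I := ∫ x in T, ∑ j, evP b x ^ 2 * evP (MvPolynomial.pderiv j P) x ^ 2 with hI
  set Y := ∫ x in T, ∑ j, evP (g j) x ^ 2 with hY
  have hM0 : 0 ≤ M := by
    obtain ⟨x, hx⟩ := hTne
    exact (sq_nonneg _).trans (hM x hx)
  have hIY : 2 * I ≤ I + M * Y := by
    have e1 : 2 * I = ∫ x in T, 2 * ∑ j, evP (g j) x * evP (b ^ 2 * MvPolynomial.pderiv j P) x := by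
      rw [integral_const_mul, hw]
    have e2 : I + M * Y = ∫ x in T, ((∑ j, evP b x ^ 2 * evP (MvPolynomial.pderiv j P) x ^ 2)
        + M * ∑ j, evP (g j) x ^ 2) := by
      rw [integral_add, integral_const_mul]
      · exact int_on T hTbdd _ (by fun_prop)
      · exact int_on T hTbdd _ (by fun_prop)
    rw [e1, e2]
    refine setIntegral_mono_on ?_ ?_ hTopen.measurableSet fun x hx => ?_
    · exact int_on T hTbdd _ (continuous_const.mul
        (continuous_finsetSum _ fun j _ => (hgc j).mul (evP_cont _)))
    · exact int_on T hTbdd _ (by fun_prop)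
    · rw [Finset.mul_sum, Finset.mul_sum, ← Finset.sum_add_distrib]
      refine Finset.sum_le_sum fun j _ => ?_
      have h1 : evP (b ^ 2 * MvPolynomial.pderiv j P) x
          = evP b x ^ 2 * evP (MvPolynomial.pderiv j P) x := by simp [evP]
      rw [h1]
      exact young _ _ _ _ (hM x hx)
  have hX : ∫ x in T, ∑ j, evP (MvPolynomial.pderiv j P) x ^ 2 ≤ c * I := by
    have i1 : ∀ j ∈ Finset.univ, Integrable (fun x => evP (MvPolynomial.pderiv j P) x ^ 2)
        (volume.restrict T) := fun j _ => int_on T hTbdd _ ((hpc j).pow 2)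
    have i2 : ∀ j ∈ Finset.univ, Integrable
        (fun x => evP b x ^ 2 * evP (MvPolynomial.pderiv j P) x ^ 2)
        (volume.restrict T) := fun j _ => int_on T hTbdd _ ((hbc.pow 2).mul ((hpc j).pow 2))
    rw [hI, integral_finsetSum _ i1, integral_finsetSum _ i2, Finset.mul_sum]
    refine Finset.sum_le_sum fun j _ => hceq _ ?_
    have := pderiv_deg P j
    omega
  have hXY : ∫ x in T, ∑ j, evP (MvPolynomial.pderiv j P) x ^ 2 ≤ (c * M) * Y := by
    have : c * I ≤ c * (M * Y) := mul_le_mul_of_nonneg_left (by linarith) hc.le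
    linarith
  calc _ ≤ Real.sqrt ((c * M) * Y) := Real.sqrt_le_sqrt hXY
    _ = Real.sqrt (c * M) * Real.sqrt Y := Real.sqrt_mul (by positivity) _
    _ ≤ _ := mul_le_mul_of_nonneg_right (by linarith) (Real.sqrt_nonneg _)
end
end

section
/- Lemma 3.4: Fix a face e_k of T and let Proj_k : ℝ^d → ℝ^d be the orthogonal projection onto the hyperplane H_k containing e_k. There exists a constant C > 0 such that for all polynomials v₀ ∈ P_k and v_g ∈ P_{k−1}, the function φ(X) = ((κ∇v₀)·n_k − v_g)(Proj_k X) · Π_{i≠k} l_i(X)² satisfies ∫_T φ(X)² dx ≤ C h_T ∫_{e_k} ((κ∇v₀)·n_k − v_g)² dH^{d−1}. -/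
open MeasureTheory RealInnerProductSpace
open scoped BigOperators

noncomputable section

lemma aux_finite_bound {V E F : Type*} [AddCommGroup V] [Module ℝ V] [FiniteDimensional ℝ V]
    [NormedAddCommGroup E] [NormedSpace ℝ E] [NormedAddCommGroup F] [NormedSpace ℝ F]
    (f : V →ₗ[ℝ] E) (g : V →ₗ[ℝ] F) (h : LinearMap.ker f ≤ LinearMap.ker g) :
    ∃ C : ℝ, ∀ v, ‖g v‖ ≤ C * ‖f v‖ := by
  let L : LinearMap.range f →ₗ[ℝ] F :=
    ((LinearMap.ker f).liftQ g h).comp f.quotKerEquivRange.symm.toLinearMap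
  let L' : LinearMap.range f →L[ℝ] F := LinearMap.toContinuousLinearMap L
  refine ⟨‖L'‖, fun v => ?_⟩
  have h1 : L' ⟨f v, LinearMap.mem_range_self f v⟩ = g v := by
    have h2 : f.quotKerEquivRange ((LinearMap.ker f).mkQ v) = ⟨f v, LinearMap.mem_range_self f v⟩ := by
      ext; simp
    have h3 : f.quotKerEquivRange.symm ⟨f v, LinearMap.mem_range_self f v⟩
        = (LinearMap.ker f).mkQ v := by
      rw [← h2]; simp
    change ((LinearMap.ker f).liftQ g h) (f.quotKerEquivRange.symm _) = g v
    rw [h3]; simp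
  rw [← h1]
  exact L'.le_opNorm _

lemma aux_norm_sq {α : Type*} [MeasurableSpace α] {μ : Measure α} {f : α → ℝ}
    (hf : MemLp f 2 μ) : ‖hf.toLp f‖ ^ 2 = ∫ x, f x ^ 2 ∂μ := by
  rw [← real_inner_self_eq_norm_sq, L2.inner_def]
  refine integral_congr_ae ?_
  filter_upwards [hf.coeFn_toLp] with x hx
  simp [hx]

def auxToLp {V α : Type*} [AddCommGroup V] [Module ℝ V] [MeasurableSpace α] (μ : Measure α)
    (f : V →ₗ[ℝ] (α → ℝ)) (hf : ∀ v, MemLp (f v) 2 μ) : V →ₗ[ℝ] Lp ℝ 2 μ where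
  toFun v := (hf v).toLp (f v)
  map_add' u v := by
    rw [← MemLp.toLp_add]
    exact MemLp.toLp_congr _ _ (by simp)
  map_smul' c v := by
    rw [RingHom.id_apply, ← MemLp.toLp_const_smul]
    exact MemLp.toLp_congr _ _ (by simp)

lemma aux_key {V α β : Type*} [AddCommGroup V] [Module ℝ V] [FiniteDimensional ℝ V]
    [MeasurableSpace α] [MeasurableSpace β] (μ : Measure α) (ν : Measure β)
    (f : V →ₗ[ℝ] (α → ℝ)) (g : V →ₗ[ℝ] (β → ℝ))
    (hf : ∀ v, MemLp (f v) 2 μ) (hg : ∀ v, MemLp (g v) 2 ν)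
    (hker : ∀ v, f v =ᵐ[μ] 0 → g v =ᵐ[ν] 0) :
    ∃ C > (0 : ℝ), ∀ v, ∫ x, (g v x) ^ 2 ∂ν ≤ C * ∫ x, (f v x) ^ 2 ∂μ := by
  obtain ⟨C, hC⟩ := aux_finite_bound (auxToLp μ f hf) (auxToLp ν g hg) (by
    intro v hv
    rw [LinearMap.mem_ker] at hv ⊢
    have h1 : (hf v).toLp (f v) = 0 := hv
    rw [Lp.eq_zero_iff_ae_eq_zero] at h1
    have h2 := hker v ((hf v).coeFn_toLp.symm.trans h1)
    change (hg v).toLp (g v) = 0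
    rw [Lp.eq_zero_iff_ae_eq_zero]
    exact (hg v).coeFn_toLp.trans h2)
  refine ⟨C ^ 2 + 1, by positivity, fun v => ?_⟩
  have h := hC v
  change ‖(hg v).toLp (g v)‖ ≤ C * ‖(hf v).toLp (f v)‖ at h
  rw [← aux_norm_sq (hg v), ← aux_norm_sq (hf v)]
  have h3 := pow_le_pow_left₀ (norm_nonneg _) h 2
  rw [mul_pow] at h3
  nlinarith [sq_nonneg ‖(hf v).toLp (f v)‖]

/-- A continuous function that is, along lines through a nonzero, polynomial has null zero set. -/
lemma aux_null {E : Type*} [NormedAddCommGroup E] [NormedSpace ℝ E] [FiniteDimensional ℝ E]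
    [MeasurableSpace E] [BorelSpace E] (μ : Measure E) [μ.IsAddHaarMeasure]
    (f : E → ℝ) (hf : Continuous f) (x₀ : E) (hx₀ : f x₀ ≠ 0)
    (hpoly : ∀ y, ∃ p : Polynomial ℝ, ∀ t : ℝ, f (x₀ + t • y) = p.eval t) :
    μ {x | f x = 0} = 0 := by
  let S : Set (E × ℝ) := {z | f (x₀ + z.2 • z.1) = 0}
  have hS : MeasurableSet S := by
    apply IsClosed.measurableSet
    exact isClosed_eq (by fun_prop) continuous_const
  have h1 : (μ.prod (volume : Measure ℝ)) S = 0 := by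
    rw [Measure.measure_prod_null hS]
    refine Filter.Eventually.of_forall fun y => ?_
    obtain ⟨p, hp⟩ := hpoly y
    have hp0 : p ≠ 0 := by
      rintro rfl
      apply hx₀
      simpa using hp 0
    refine Set.Finite.measure_zero ?_ _
    refine (Polynomial.finite_setOf_isRoot hp0).subset ?_
    intro t ht
    have : f (x₀ + t • y) = 0 := ht
    rw [hp] at this
    exact this
  have h2 : ((volume : Measure ℝ).prod μ) (Prod.swap ⁻¹' S) = 0 := by
    rw [← Measure.map_apply measurable_swap hS, Measure.prod_swap]
    exact h1
  have h3 := Measure.measure_ae_null_of_prod_null h2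
  have h4 : ∀ᵐ t : ℝ, t ≠ 0 := by
    simp [ae_iff]
  obtain ⟨t, ht, ht0⟩ := (h3.and h4).exists
  have h5 : (Prod.mk t ⁻¹' (Prod.swap ⁻¹' S)) = (t • ·) ⁻¹' ((x₀ + ·) ⁻¹' {x | f x = 0}) := by
    ext y; simp [S]
  change μ (Prod.mk t ⁻¹' (Prod.swap ⁻¹' S)) = 0 at ht
  rw [h5, Measure.addHaar_preimage_smul _ ht0, measure_preimage_add] at ht
  simpa [ht0] using ht

lemma aux_pder_s4 (d : ℕ) (P : MvPolynomial (Fin d) ℝ) (x : EuclideanSpace ℝ (Fin d)) :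
    HasFDerivAt (fun x : EuclideanSpace ℝ (Fin d) => MvPolynomial.eval (fun j => x j) P)
      (∑ b, MvPolynomial.eval (fun j => x j) (MvPolynomial.pderiv b P) •
        (EuclideanSpace.proj b : EuclideanSpace ℝ (Fin d) →L[ℝ] ℝ)) x := by
  induction P using MvPolynomial.induction_on with
  | C a => simpa using hasFDerivAt_const a x
  | add p q hp hq =>
    simp only [map_add, add_smul, Finset.sum_add_distrib]
    exact hp.add hq
  | mul_X p i hp =>
    have h := hp.mul (EuclideanSpace.proj i : EuclideanSpace ℝ (Fin d) →L[ℝ] ℝ).hasFDerivAt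
    simp only [map_mul, MvPolynomial.eval_X, Derivation.leibniz, smul_eq_mul, map_add,
      MvPolynomial.pderiv_X]
    refine h.congr_fderiv ?_
    simp only [add_smul, Finset.sum_add_distrib, Finset.smul_sum, smul_smul]
    congr 1
    rw [Finset.sum_eq_single i]
    · simp
    · intro b _ hb
      simp [Pi.single_apply, hb.symm]
    · simp

lemma aux_cont (d : ℕ) (P : MvPolynomial (Fin d) ℝ) :
    Continuous (fun x : EuclideanSpace ℝ (Fin d) => MvPolynomial.eval (fun j => x j) P) :=
  P.continuous_eval.comp (by fun_prop)

/-- The polynomial `(κ∇P)·ν - Q`. -/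
def auxG (d : ℕ) (κ : Matrix (Fin d) (Fin d) ℝ) (ν : EuclideanSpace ℝ (Fin d)) (k l : ℕ) :
    (MvPolynomial.restrictTotalDegree (Fin d) ℝ k ×
      MvPolynomial.restrictTotalDegree (Fin d) ℝ l) →ₗ[ℝ] MvPolynomial (Fin d) ℝ where
  toFun v := (∑ a, ∑ b, (κ a b * ν a) • MvPolynomial.pderiv b v.1.1) - v.2.1
  map_add' u v := by
    simp only [Prod.fst_add, Prod.snd_add, Submodule.coe_add, map_add, smul_add,
      Finset.sum_add_distrib]
    abel
  map_smul' c v := by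
    simp only [Prod.smul_fst, Prod.smul_snd, Submodule.coe_smul, Derivation.map_smul,
      RingHom.id_apply, smul_sub, Finset.smul_sum]
    congr 1
    refine Finset.sum_congr rfl fun a _ => Finset.sum_congr rfl fun b _ => ?_
    rw [smul_comm]

lemma aux_memLp {α : Type*} [TopologicalSpace α] [MeasurableSpace α] [BorelSpace α] 
    (μ : Measure α) (s K : Set α) (hK : IsCompact K) (hs : s ⊆ K) (hms : MeasurableSet s)
    (hμ : μ s < ⊤) (f : α → ℝ) (hf : Continuous f) : MemLp f 2 (μ.restrict s) := by
  haveI : IsFiniteMeasure (μ.restrict s) := ⟨by simpa using hμ⟩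
  obtain ⟨C, hC⟩ := hK.exists_bound_of_continuousOn hf.continuousOn
  refine MemLp.of_bound hf.aestronglyMeasurable C ?_
  filter_upwards [ae_restrict_mem hms] with x hx
  exact hC x (hs hx)

/-- Lemma 3.4. -/
theorem stmt4 (d N : ℕ) (hd : 2 ≤ d) (hN : 1 ≤ N)
    (T : Set (EuclideanSpace ℝ (Fin d))) (hTopen : IsOpen T) (hTne : T.Nonempty)
    (hTbdd : Bornology.IsBounded T)
    (e : Fin N → Set (EuclideanSpace ℝ (Fin d)))
    (A n : Fin N → EuclideanSpace ℝ (Fin d)) (hn : ∀ i, ‖n i‖ = 1)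
    (he_cpt : ∀ i, IsCompact (e i))
    (he_sub : ∀ i, e i ⊆ {x | ⟪x - A i, n i⟫ = 0})
    (he_pos : ∀ i, 0 < μH[((d : ℝ) - 1)] (e i))
    (hbd : frontier T = ⋃ i, e i)
    (κ : Matrix (Fin d) (Fin d) ℝ) (hκ : κ.PosDef)
    (hT : ℝ) (hT0 : 0 < hT) (hTdiam : hT = Metric.diam T)
    (k : ℕ) (hk : 1 ≤ k) (k₀ : Fin N) :
    ∃ C > (0 : ℝ), ∀ v₀ vg : EuclideanSpace ℝ (Fin d) → ℝ,
      IsPolyDeg d k v₀ → IsPolyDeg d (k - 1) vg →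
      ∫ x in T, ((kGradDot d κ v₀ (n k₀) (projH d (A k₀) (n k₀) x) -
            vg (projH d (A k₀) (n k₀) x)) *
          ∏ i ∈ Finset.univ.erase k₀, (lfun d N hT A n i x) ^ 2) ^ 2 ≤
        C * hT * ∫ x in e k₀, (kGradDot d κ v₀ (n k₀) x - vg x) ^ 2 ∂μH[((d : ℝ) - 1)] := by
  classical
  have hn0 : n k₀ ≠ 0 := by
    intro h; have := hn k₀; rw [h] at this; simp at this
  let W := (Submodule.span ℝ {n k₀})ᗮ
  have hfr : (Module.finrank ℝ W : ℝ) = (d : ℝ) - 1 := by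
    obtain ⟨m, rfl⟩ : ∃ m, d = m + 1 := ⟨d - 1, by omega⟩
    haveI : Fact (Module.finrank ℝ (EuclideanSpace ℝ (Fin (m + 1))) = m + 1) := ⟨by simp⟩
    have := Submodule.finrank_orthogonal_span_singleton (𝕜 := ℝ) (n := m) hn0
    change Module.finrank ℝ W = m at this
    rw [this]; push_cast; ring
  have hd0 : (0 : ℝ) ≤ (d : ℝ) - 1 := by rw [← hfr]; positivity
  let μ : Measure W := μH[((d : ℝ) - 1)]
  haveI : μ.IsAddHaarMeasure := by
    have := isAddHaarMeasure_hausdorffMeasure (E := W)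
    rw [hfr] at this
    exact this
  let φ : W → EuclideanSpace ℝ (Fin d) := fun y => A k₀ + (y : EuclideanSpace ℝ (Fin d))
  have hφ : Isometry φ := by
    refine Isometry.of_dist_eq fun x y => ?_
    simp [φ, Subtype.dist_eq]
  have hφr : ∀ x, ⟪x - A k₀, n k₀⟫ = 0 → ∃ y, φ y = x := by
    intro x hx
    refine ⟨⟨x - A k₀, ?_⟩, by simp [φ]⟩
    rw [Submodule.mem_orthogonal_singleton_iff_inner_left]
    exact hx
  have hproj : ∀ x, ⟪projH d (A k₀) (n k₀) x - A k₀, n k₀⟫ = 0 := by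
    intro x
    have : projH d (A k₀) (n k₀) x - A k₀ = (x - A k₀) - ⟪x - A k₀, n k₀⟫ • n k₀ := by
      simp only [projH]; abel
    rw [this, inner_sub_left, real_inner_smul_left, real_inner_self_eq_norm_sq, hn k₀]
    ring
  have hsr : e k₀ ⊆ Set.range φ := fun x hx => hφr x (he_sub k₀ hx)
  have hmeas : ∀ s ⊆ e k₀, μ (φ ⁻¹' s) = μH[((d : ℝ) - 1)] s := by
    intro s hs
    rw [hφ.hausdorffMeasure_preimage (Or.inl hd0),
      Set.inter_eq_self_of_subset_left (hs.trans hsr)]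
  have hfin : μH[((d : ℝ) - 1)] (e k₀) < ⊤ := by
    rw [← hmeas _ subset_rfl]
    have : IsCompact (φ ⁻¹' (e k₀)) :=
      (hφ.isClosedEmbedding).isCompact_preimage (he_cpt k₀)
    exact this.measure_lt_top
  let G := auxG d κ (n k₀) k (k - 1)
  let V := MvPolynomial.restrictTotalDegree (Fin d) ℝ k ×
      MvPolynomial.restrictTotalDegree (Fin d) ℝ (k - 1)
  let pr : EuclideanSpace ℝ (Fin d) → ℝ :=
    fun x => ∏ i ∈ Finset.univ.erase k₀, (lfun d N hT A n i x) ^ 2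
  have hprc : Continuous pr := by
    refine continuous_finsetProd _ fun i _ => ?_
    unfold lfun
    fun_prop
  have hpc : Continuous (projH d (A k₀) (n k₀)) := by
    unfold projH
    fun_prop
  let f : V →ₗ[ℝ] (EuclideanSpace ℝ (Fin d) → ℝ) :=
    { toFun := fun v x => MvPolynomial.eval (fun j => x j) (G v)
      map_add' := by intro u v; ext x; simp
      map_smul' := by intro c v; ext x; simp }
  let g : V →ₗ[ℝ] (EuclideanSpace ℝ (Fin d) → ℝ) :=
    { toFun := fun v x => f v (projH d (A k₀) (n k₀) x) * pr x
      map_add' := by intro u v; ext x; simp [add_mul]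
      map_smul' := by intro c v; ext x; simp [mul_assoc] }
  have hfc : ∀ v, Continuous (f v) := fun v => aux_cont d (G v)
  have hgc : ∀ v, Continuous (g v) := fun v => ((hfc v).comp hpc).mul hprc
  obtain ⟨C, hC0, hC⟩ := aux_key ((μH[((d : ℝ) - 1)]).restrict (e k₀)) (volume.restrict T) f g
    (fun v => aux_memLp _ _ _ (he_cpt k₀) subset_rfl (he_cpt k₀).measurableSet hfin _ (hfc v))
    (fun v => aux_memLp _ _ _ hTbdd.isCompact_closure subset_closure hTopen.measurableSet
      hTbdd.measure_lt_top _ (hgc v))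
    (by
      intro v hv
      have hz : ∀ y, f v (φ y) = 0 := by
        by_contra! hcon
        obtain ⟨y₀, hy₀⟩ := hcon
        have hnull := aux_null μ (fun y => f v (φ y)) ((hfc v).comp hφ.continuous) y₀ hy₀ (by
          intro y
          refine ⟨MvPolynomial.aeval (fun j => Polynomial.C (φ y₀ j) +
            Polynomial.X * Polynomial.C ((y : EuclideanSpace ℝ (Fin d)) j)) (G v), fun t => ?_⟩
          change MvPolynomial.eval _ (G v) = Polynomial.evalRingHom t _
          rw [MvPolynomial.aeval_def, MvPolynomial.hom_eval₂]
          rw [MvPolynomial.eval, MvPolynomial.coe_eval₂Hom]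
          congr 1
          · ext; simp
          · ext j; simp [φ]; ring)
        have h1 := he_pos k₀
        rw [← hmeas _ subset_rfl] at h1
        have h2 : μH[((d : ℝ) - 1)] (e k₀ ∩ {x | f v x ≠ 0}) = 0 := by
          have := ae_iff.1 hv
          rw [Measure.restrict_apply₀' (he_cpt k₀).measurableSet.nullMeasurableSet] at this
          rw [Set.inter_comm]
          exact this
        rw [← hmeas _ Set.inter_subset_left] at h2
        refine h1.ne' (measure_mono_null ?_ (measure_union_null hnull h2))
        intro y hy
        by_cases h : f v (φ y) = 0
        · exact Or.inl h
        · exact Or.inr ⟨hy, h⟩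
      refine Filter.Eventually.of_forall fun x => ?_
      obtain ⟨y, hy⟩ := hφr _ (hproj x)
      change f v (projH d (A k₀) (n k₀) x) * pr x = 0
      rw [← hy, hz, zero_mul])
  refine ⟨C / hT, by positivity, ?_⟩
  rintro v₀ vg ⟨P, hP, hP'⟩ ⟨Q, hQ, hQ'⟩
  have hv := hC (⟨P, (MvPolynomial.mem_restrictTotalDegree _ _ _).2 hP⟩,
    ⟨Q, (MvPolynomial.mem_restrictTotalDegree _ _ _).2 hQ⟩)
  have hfe : ∀ x, f (⟨P, (MvPolynomial.mem_restrictTotalDegree _ _ _).2 hP⟩,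
      ⟨Q, (MvPolynomial.mem_restrictTotalDegree _ _ _).2 hQ⟩) x
      = kGradDot d κ v₀ (n k₀) x - vg x := by
    intro x
    have hv0 : v₀ = fun x : EuclideanSpace ℝ (Fin d) => MvPolynomial.eval (fun j => x j) P :=
      funext hP'
    have hpd : ∀ b, pder d b v₀ x = MvPolynomial.eval (fun j => x j) (MvPolynomial.pderiv b P) := by
      intro b
      rw [hv0, pder, (aux_pder_s4 d P x).fderiv]
      simp [ContinuousLinearMap.sum_apply, Pi.single_apply]
    change MvPolynomial.eval _ ((∑ a, ∑ b, (κ a b * n k₀ a) • MvPolynomial.pderiv b P) - Q) = _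
    rw [kGradDot, hQ', map_sub, map_sum]
    congr 1
    refine Finset.sum_congr rfl fun a _ => ?_
    rw [map_sum, Finset.sum_mul]
    refine Finset.sum_congr rfl fun b _ => ?_
    rw [MvPolynomial.smul_eval, hpd]
    ring
  rw [div_mul_cancel₀ _ hT0.ne']
  simp only [← hfe]
  exact hv
end
end
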